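/- Let d be a positive integer and x_p ∈ EuclideanSpace ℝ (Fin d) with x_p ≠ 0. Let D_cl = ((x_1,y_1),…,(x_n,y_n)) be labeled samples with y_i ∈ {−1,1} and ⟨x_i, x_p⟩ = 0 for every i, let C > 0, and let D_poi be D_cl together with the extra sample (x_p, +1). Suppose α (indexed by the n+1 samples of D_poi) with components in [0,C] maximizes the dual objective W(α) = Σ_i α_i − (1/2)·Σ_{i,j} α_i·α_j·y_i·y_j·⟨x_i, x_j⟩ over the box, and let w = Σ_i α_i·y_i·x_i (sums over all samples of D_poi, the poison sample having label +1). Let f_cl be the unique minimizer of the regularized hinge loss L_H(D_cl, ·). Then for every x ∈ EuclideanSpace ℝ (Fin d) with ⟨x, x_p⟩ = 0, one has ⟨w, x⟩ = ⟨f_cl, x⟩. -/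

import Mathlib

open scoped RealInnerProductSpace BigOperators

section SVM

variable {ι E : Type*} [Fintype ι] [NormedAddCommGroup E] [InnerProductSpace ℝ E]

theorem sum_sum_mul_inner_eq_norm_sq (a y : ι → ℝ) (x : ι → E) :
    ∑ i, ∑ j, a i * a j * y i * y j * ⟪x i, x j⟫ = ‖∑ i, (a i * y i) • x i‖ ^ 2 := by
  rw [← real_inner_self_eq_norm_sq, sum_inner]
  refine Finset.sum_congr rfl fun i _ => ?_
  rw [inner_sum]
  refine Finset.sum_congr rfl fun j _ => ?_
  rw [real_inner_smul_left, real_inner_smul_right]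
  ring

/-- If `s * b ≤ s ^ 2 * c` for all `s ∈ [0, 1]`, then `b ≤ 0`. -/
theorem nonpos_of_mul_le_sq_mul {b c : ℝ}
    (h : ∀ s : ℝ, 0 ≤ s → s ≤ 1 → s * b ≤ s ^ 2 * c) : b ≤ 0 := by
  by_contra! hb
  have hpos : 0 < b + |c| := by positivity
  have hs : 0 < b / (2 * (b + |c|)) := by positivity
  have hle : b / (2 * (b + |c|)) ≤ 1 := by
    rw [div_le_one (by positivity)]
    linarith [abs_nonneg c]
  have key := h _ hs.le hle
  rw [pow_two, mul_assoc, mul_le_mul_iff_right₀ hs, div_mul_eq_mul_div,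
    le_div_iff₀ (by positivity)] at key
  nlinarith [le_abs_self c]

/-- First-order optimality, one coordinate at a time, for the dual of the soft-margin SVM with
signed samples `z i`. -/
theorem svm_dual_variational_inequality {C : ℝ} {z : ι → E} {a : ι → ℝ}
    (hbox : ∀ i, 0 ≤ a i ∧ a i ≤ C)
    (hmax : ∀ b : ι → ℝ, (∀ i, 0 ≤ b i ∧ b i ≤ C) →
      ∑ i, b i - (1 / 2) * ‖∑ i, b i • z i‖ ^ 2 ≤ ∑ i, a i - (1 / 2) * ‖∑ i, a i • z i‖ ^ 2)
    (k : ι) {t : ℝ} (ht : 0 ≤ t) (htC : t ≤ C) :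
    (t - a k) * (1 - ⟪∑ i, a i • z i, z k⟫) ≤ 0 := by
  classical
  refine nonpos_of_mul_le_sq_mul (c := (1 / 2) * ((t - a k) ^ 2 * ‖z k‖ ^ 2))
    fun s hs hs1 => ?_
  obtain ⟨ha, haC⟩ := hbox k
  have key := hmax (fun i => a i + if i = k then s * (t - a k) else 0) fun i => by
    split_ifs with hik
    · subst hik
      constructor <;> nlinarith
    · simpa using hbox i
  simp only [Finset.sum_add_distrib, add_smul, ite_smul, zero_smul, Finset.sum_ite_eq',
    Finset.mem_univ, if_true] at key
  rw [norm_add_sq_real, real_inner_smul_right, norm_smul, mul_pow, Real.norm_eq_abs,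
    sq_abs] at key
  linear_combination key

/-- Complementary slackness: an optimal dual coefficient turns the hinge loss into a linear
function of the margin. -/
theorem mul_max_zero_eq_of_variational {C a m : ℝ} (ha : 0 ≤ a) (haC : a ≤ C)
    (h : ∀ t, 0 ≤ t → t ≤ C → (t - a) * m ≤ 0) : C * max 0 m = a * m := by
  have h0 := h 0 le_rfl (ha.trans haC)
  have hC := h C (ha.trans haC) le_rfl
  rcases le_total 0 m with hm | hm
  · rw [max_eq_right hm]
    nlinarith
  · rw [max_eq_left hm]
    nlinarith

/-- If the coefficients `a` satisfy complementary slackness, then `∑ i, a i • z i` minimizes the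
regularized hinge loss, with quadratic growth around it. -/
theorem hinge_loss_quadratic_growth {C : ℝ} {z : ι → E} {a : ι → ℝ}
    (hbox : ∀ i, 0 ≤ a i ∧ a i ≤ C)
    (hslack : ∀ k, C * max 0 (1 - ⟪∑ i, a i • z i, z k⟫) = a k * (1 - ⟪∑ i, a i • z i, z k⟫))
    (f : E) :
    (1 / 2) * ‖∑ i, a i • z i‖ ^ 2 + C * ∑ k, max 0 (1 - ⟪∑ i, a i • z i, z k⟫)
        + (1 / 2) * ‖f - ∑ i, a i • z i‖ ^ 2
      ≤ (1 / 2) * ‖f‖ ^ 2 + C * ∑ k, max 0 (1 - ⟪f, z k⟫) := by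
  have hlin (g : E) : ∑ k, a k * (1 - ⟪g, z k⟫) = ∑ k, a k - ⟪g, ∑ i, a i • z i⟫ := by
    simp only [mul_sub, mul_one, Finset.sum_sub_distrib, inner_sum, real_inner_smul_right]
  have hf : ∑ k, a k * (1 - ⟪f, z k⟫) ≤ C * ∑ k, max 0 (1 - ⟪f, z k⟫) := by
    rw [Finset.mul_sum]
    refine Finset.sum_le_sum fun k _ => ?_
    obtain ⟨h0, hC⟩ := hbox k
    exact (mul_le_mul_of_nonneg_left (le_max_right _ _) h0).trans
      (mul_le_mul_of_nonneg_right hC (le_max_left _ _))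
  have hw : C * ∑ k, max 0 (1 - ⟪∑ i, a i • z i, z k⟫)
      = ∑ k, a k - ⟪∑ i, a i • z i, ∑ i, a i • z i⟫ := by
    rw [Finset.mul_sum, ← hlin]
    exact Finset.sum_congr rfl fun k _ => hslack k
  rw [hlin] at hf
  rw [hw, norm_sub_sq_real, real_inner_self_eq_norm_sq]
  linarith

end SVM

/-- Training by dual optimization on poisoned data is functionally equivalent,
on all benign inputs orthogonal to the poison direction, to clean training. -/
theorem stmt_18 (d n : ℕ) (hd : 0 < d)
    (x_p : EuclideanSpace ℝ (Fin d)) (hxp : x_p ≠ 0)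
    (x : Fin n → EuclideanSpace ℝ (Fin d)) (y : Fin n → ℝ)
    (hy : ∀ i, y i = -1 ∨ y i = 1)
    (horth : ∀ i, ⟪x i, x_p⟫ = 0)
    (C : ℝ) (hC : 0 < C)
    (xp' : Fin (n + 1) → EuclideanSpace ℝ (Fin d)) (yp' : Fin (n + 1) → ℝ)
    (hxp' : xp' = Fin.snoc x x_p) (hyp' : yp' = Fin.snoc y 1)
    (W : (Fin (n + 1) → ℝ) → ℝ)
    (hW : W = fun α => ∑ i, α i
      - (1 / 2) * ∑ i, ∑ j, α i * α j * yp' i * yp' j * ⟪xp' i, xp' j⟫)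
    (α : Fin (n + 1) → ℝ) (hbox : ∀ i, 0 ≤ α i ∧ α i ≤ C)
    (hmax : ∀ β : Fin (n + 1) → ℝ, (∀ i, 0 ≤ β i ∧ β i ≤ C) → W β ≤ W α)
    (w : EuclideanSpace ℝ (Fin d)) (hw : w = ∑ i, (α i * yp' i) • xp' i)
    (Lcl : EuclideanSpace ℝ (Fin d) → ℝ)
    (hLcl : Lcl = fun f => (1 / 2) * ‖f‖ ^ 2 + C * ∑ i, max 0 (1 - y i * ⟪f, x i⟫))
    (f_cl : EuclideanSpace ℝ (Fin d))
    (hmincl : ∀ f, Lcl f_cl ≤ Lcl f) :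
    ∀ x' : EuclideanSpace ℝ (Fin d), ⟪x', x_p⟫ = 0 → ⟪w, x'⟫ = ⟪f_cl, x'⟫ := by
  subst hxp' hyp' hW hw hLcl
  intro x' hx'
  set u : EuclideanSpace ℝ (Fin d) := ∑ i, α (Fin.castSucc i) • (y i • x i) with hu
  have hsplit : ∑ i, α i • ((Fin.snoc y 1 : Fin (n + 1) → ℝ) i •
      (Fin.snoc x x_p : Fin (n + 1) → EuclideanSpace ℝ (Fin d)) i)
      = u + α (Fin.last n) • x_p := by
    simp [Fin.sum_univ_castSucc, hu]
  have hvar (k : Fin n) (t : ℝ) (ht : 0 ≤ t) (htC : t ≤ C) :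
      (t - α k.castSucc) * (1 - ⟪u, y k • x k⟫) ≤ 0 := by
    have h := svm_dual_variational_inequality hbox
      (fun b hb => by
        simpa only [sum_sum_mul_inner_eq_norm_sq, mul_smul] using hmax b hb) k.castSucc ht htC
    rw [hsplit] at h
    simpa [inner_add_left, real_inner_smul_left, real_inner_smul_right,
      real_inner_comm (x k) x_p, horth k] using h
  have hgrowth := hinge_loss_quadratic_growth (fun i : Fin n => hbox i.castSucc)
    (fun k => mul_max_zero_eq_of_variational (hbox _).1 (hbox _).2 (hvar k)) f_cl
  have hmin := hmincl u
  simp only [← hu, real_inner_smul_right] at hgrowth hmin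
  have hzero : ‖f_cl - u‖ ^ 2 ≤ 0 := by linarith
  have hfu : f_cl = u := by
    simpa [sub_eq_zero] using hzero.antisymm (sq_nonneg _)
  simp only [mul_smul]
  rw [hsplit, hfu, inner_add_left, real_inner_smul_left, real_inner_comm x' x_p, hx', mul_zero, add_zero]
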